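/- Let 3 ≤ n ≤ N, θ_n ∈ [0,1/2], and α ∈ (0,1). Then a_{n−2}^{(α)} − a_{n−1}^{(α)} ≥ b_{n−2}^{(α)} + (3/2) I_{n−1}^{(α)}, and for every 2 ≤ k ≤ n−2 one has a_{n−k−1}^{(α)} − a_{n−k}^{(α)} ≥ b_{n−k−1}^{(α)} + ρ_{k−1} b_{n−k+1}^{(α)} + I_{n−k}^{(α)}. -/

import Mathlib

open Real MeasureTheory

/-- Graded mesh point `t_j = T (j/N)^r`. -/
noncomputable def gridT (T r : ℝ) (N j : ℕ) : ℝ := T * ((j : ℝ) / (N : ℝ)) ^ r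

/-- Step size `τ_j = t_j - t_{j-1}`. -/
noncomputable def gridTau (T r : ℝ) (N j : ℕ) : ℝ := gridT T r N j - gridT T r N (j - 1)

/-- Step-size ratio `ρ_j = τ_j / τ_{j+1}`. -/
noncomputable def gridRho (T r : ℝ) (N j : ℕ) : ℝ := gridTau T r N j / gridTau T r N (j + 1)

/-- Offset point `t_{n-θ} = θ t_{n-1} + (1-θ) t_n`. -/
noncomputable def tTheta (T r : ℝ) (N n : ℕ) (θ : ℝ) : ℝ :=
  θ * gridT T r N (n - 1) + (1 - θ) * gridT T r N n

/-- Coefficient `a_{n-k}^{(α)}`, parametrized by `k`. -/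
noncomputable def coefA (T r : ℝ) (N n : ℕ) (θ α : ℝ) (k : ℕ) : ℝ :=
  (1 / (gridTau T r N k * Real.Gamma (1 - α))) *
    ∫ s in (gridT T r N (k - 1))..(min (gridT T r N k) (tTheta T r N n θ)),
      (tTheta T r N n θ - s) ^ (-α)

/-- Coefficient `b_{n-k}^{(α)}`, parametrized by `k`. -/
noncomputable def coefB (T r : ℝ) (N n : ℕ) (θ α : ℝ) (k : ℕ) : ℝ :=
  (2 / (gridTau T r N k * (gridTau T r N k + gridTau T r N (k + 1)) * Real.Gamma (1 - α))) *
    ∫ s in (gridT T r N (k - 1))..(gridT T r N k),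
      (s - (gridT T r N (k - 1) + gridT T r N k) / 2) * (tTheta T r N n θ - s) ^ (-α)

/-- Coefficient `I_{n-k}^{(α)}`, parametrized by `k`. -/
noncomputable def coefI (T r : ℝ) (N n : ℕ) (θ α : ℝ) (k : ℕ) : ℝ :=
  (α / (Real.Gamma (1 - α) * gridTau T r N k)) *
    ∫ s in (gridT T r N (k - 1))..(gridT T r N k),
      (gridT T r N k - s) * (tTheta T r N n θ - s) ^ (-α - 1)

/-- Coefficient `J_{n-k}^{(α)}`, parametrized by `k`. -/
noncomputable def coefJ (T r : ℝ) (N n : ℕ) (θ α : ℝ) (k : ℕ) : ℝ :=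
  (α / (Real.Gamma (1 - α) * gridTau T r N k)) *
    ∫ s in (gridT T r N (k - 1))..(gridT T r N k),
      (s - gridT T r N (k - 1)) * (tTheta T r N n θ - s) ^ (-α - 1)

/-- Coefficient `c_{n-k,n}^{(α)}`, parametrized by `k` (`1 ≤ k ≤ n`). -/
noncomputable def coefC (T r : ℝ) (N n : ℕ) (θ α : ℝ) (k : ℕ) : ℝ :=
  if n = 1 then coefA T r N n θ α n
  else if k = n then coefA T r N n θ α n + gridRho T r N (n - 1) * coefB T r N n θ α (n - 1)
  else if k = 1 then coefA T r N n θ α 1 - coefB T r N n θ α 1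
  else coefA T r N n θ α k + gridRho T r N (k - 1) * coefB T r N n θ α (k - 1)
         - coefB T r N n θ α k

open Set

/-- Trapezoidal half of the Hermite–Hadamard inequality. -/
lemma ConvexOn.integral_le_trapezoid {f : ℝ → ℝ} {u v : ℝ} (hf : ConvexOn ℝ (Icc u v) f)
    (hc : ContinuousOn f (Icc u v)) (huv : u < v) :
    ∫ s in u..v, f s ≤ (v - u) * ((f u + f v) / 2) := by
  have hchord : ∫ s in u..v, (f u + (f v - f u) / (v - u) * (s - u))
      = (v - u) * ((f u + f v) / 2) := by
    rw [intervalIntegral.integral_add (by simp) ((by fun_prop : Continuous _).intervalIntegrable _ _),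
      intervalIntegral.integral_const_mul, intervalIntegral.integral_sub (by simp) (by simp)]
    simp only [intervalIntegral.integral_const, integral_id, smul_eq_mul]
    have : v - u ≠ 0 := by linarith
    field_simp
    ring
  rw [← hchord]
  refine intervalIntegral.integral_mono_on huv.le (hc.intervalIntegrable_of_Icc huv.le)
    ((by fun_prop : Continuous _).intervalIntegrable _ _) fun s hs => ?_
  rcases hs.1.eq_or_lt with rfl | hus
  · simp
  rcases hs.2.eq_or_lt with rfl | hsv
  · have : s - u ≠ 0 := by linarith
    field_simp
    linarith
  have h := hf.secant_mono_aux2 (left_mem_Icc.2 huv.le) (right_mem_Icc.2 huv.le) hus hsv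
  rw [div_le_iff₀ (by linarith)] at h
  linarith

/-- A convex function lies above its extrapolated secant, in integrated form. -/
lemma ConvexOn.secant_le_integral {f : ℝ → ℝ} {u v w : ℝ} (hf : ConvexOn ℝ (Icc u w) f)
    (hc : ContinuousOn f (Icc u w)) (huv : u < v) (hvw : v < w) :
    (w - v) * (f v + (f v - f u) / (v - u) * ((w - v) / 2)) ≤ ∫ s in v..w, f s := by
  have hsec : ∫ s in v..w, (f v + (f v - f u) / (v - u) * (s - v))
      = (w - v) * (f v + (f v - f u) / (v - u) * ((w - v) / 2)) := by
    rw [intervalIntegral.integral_add (by simp) ((by fun_prop : Continuous _).intervalIntegrable _ _),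
      intervalIntegral.integral_const_mul, intervalIntegral.integral_sub (by simp) (by simp)]
    simp only [intervalIntegral.integral_const, integral_id, smul_eq_mul]
    ring
  rw [← hsec]
  refine intervalIntegral.integral_mono_on hvw.le
    ((by fun_prop : Continuous _).intervalIntegrable _ _)
    ((hc.mono (Icc_subset_Icc_left huv.le)).intervalIntegrable_of_Icc hvw.le) fun s hs => ?_
  rcases hs.1.eq_or_lt with rfl | hvs
  · simp
  have h := hf.slope_mono_adjacent (left_mem_Icc.2 (huv.trans hvw).le)
    ⟨(huv.trans hvs).le, hs.2⟩ huv hvs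
  rw [le_div_iff₀ (by linarith)] at h
  linarith

/-- The first moment of a monotone function about the midpoint is controlled by the excess of its
integral over the left-endpoint value. -/
lemma MonotoneOn.integral_sub_midpoint_mul_le {f : ℝ → ℝ} {u v : ℝ} (hf : MonotoneOn f (Icc u v))
    (hc : ContinuousOn f (Icc u v)) (huv : u ≤ v) :
    ∫ s in u..v, (s - (u + v) / 2) * f s
      ≤ (v - u) / 2 * ((∫ s in u..v, f s) - (v - u) * f u) := by
  have hfi := hc.intervalIntegrable_of_Icc (μ := volume) huv
  have hR : ∫ s in u..v, ((v - u) / 2 * (f s - f u) + (s - (u + v) / 2) * f u)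
      = (v - u) / 2 * ((∫ s in u..v, f s) - (v - u) * f u) := by
    rw [intervalIntegral.integral_add ((hfi.sub (by simp)).const_mul _)
        ((by fun_prop : Continuous _).intervalIntegrable _ _),
      intervalIntegral.integral_const_mul, intervalIntegral.integral_mul_const,
      intervalIntegral.integral_sub hfi (by simp),
      intervalIntegral.integral_sub (by simp) (by simp)]
    simp only [intervalIntegral.integral_const, integral_id, smul_eq_mul]
    ring
  rw [← hR]
  refine intervalIntegral.integral_mono_on huv
    (ContinuousOn.intervalIntegrable_of_Icc huv (by fun_prop))
    (((hfi.sub (by simp)).const_mul _).add ((by fun_prop : Continuous _).intervalIntegrable _ _))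
    fun s hs => ?_
  nlinarith [hf (left_mem_Icc.2 huv) hs hs.1, hs.2]

section Kernel

variable {S α : ℝ}

lemma hasDerivAt_sub_rpow_neg {s : ℝ} (hs : s < S) :
    HasDerivAt (fun s => (S - s) ^ (-α)) (α * (S - s) ^ (-α - 1)) s := by
  have h := ((hasDerivAt_id s).const_sub S).rpow_const (p := -α) (Or.inl (sub_pos.2 hs).ne')
  simpa using h

lemma continuousOn_sub_rpow_neg : ContinuousOn (fun s => (S - s) ^ (-α)) (Iio S) :=
  fun _ hs => (hasDerivAt_sub_rpow_neg hs).continuousAt.continuousWithinAt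

lemma monotoneOn_sub_rpow_neg (hα : 0 ≤ α) : MonotoneOn (fun s => (S - s) ^ (-α)) (Iio S) :=
  fun _ _ y hy hxy => rpow_le_rpow_of_nonpos (sub_pos.2 hy) (by linarith) (by linarith)

lemma convexOn_sub_rpow_neg (hα : 0 ≤ α) : ConvexOn ℝ (Iio S) (fun s => (S - s) ^ (-α)) := by
  refine MonotoneOn.convexOn_of_deriv (convex_Iio S) continuousOn_sub_rpow_neg ?_ ?_ <;>
    rw [interior_Iio]
  · exact fun s hs => (hasDerivAt_sub_rpow_neg hs).differentiableAt.differentiableWithinAt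
  · intro x hx y hy hxy
    rw [(hasDerivAt_sub_rpow_neg hx).deriv, (hasDerivAt_sub_rpow_neg hy).deriv]
    exact mul_le_mul_of_nonneg_left
      (rpow_le_rpow_of_nonpos (sub_pos.2 hy) (by linarith) (by linarith)) hα

lemma integral_sub_mul_sub_rpow {u v : ℝ} (huv : u ≤ v) (hv : v < S) :
    α * ∫ s in u..v, (v - s) * (S - s) ^ (-α - 1)
      = (∫ s in u..v, (S - s) ^ (-α)) - (v - u) * (S - u) ^ (-α) := by
  have hsub : Icc u v ⊆ Iio S := fun s hs => hs.2.trans_lt hv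
  have hc := (continuousOn_sub_rpow_neg (S := S) (α := α)).mono hsub
  have hc' : ContinuousOn (fun s => (S - s) ^ (-α - 1)) (Icc u v) := by
    simpa only [neg_add'] using (continuousOn_sub_rpow_neg (S := S) (α := α + 1)).mono hsub
  have hi := hc.intervalIntegrable_of_Icc (μ := volume) huv
  have hi' : IntervalIntegrable (fun s => (v - s) * (S - s) ^ (-α - 1)) volume u v :=
    ContinuousOn.intervalIntegrable_of_Icc huv (by fun_prop)
  have hd : ∀ s ∈ uIcc u v, HasDerivAt (fun s => (v - s) * (S - s) ^ (-α))
      (α * ((v - s) * (S - s) ^ (-α - 1)) - (S - s) ^ (-α)) s := fun s hs => by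
    rw [uIcc_of_le huv] at hs
    convert! ((hasDerivAt_id s).const_sub v).mul (hasDerivAt_sub_rpow_neg (hsub hs)) using 1
    simp
    ring
  have h := intervalIntegral.integral_eq_sub_of_hasDerivAt hd ((hi'.const_mul α).sub hi)
  rw [intervalIntegral.integral_sub (hi'.const_mul α) hi,
    intervalIntegral.integral_const_mul] at h
  simp only [sub_self, zero_mul, zero_sub] at h
  linarith

end Kernel

section Mesh

variable {T r : ℝ} {N : ℕ}

lemma gridTau_succ_pos (hT : 0 < T) (hr : 1 ≤ r) (hN : 1 ≤ N) (j : ℕ) :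
    0 < gridTau T r N (j + 1) := by
  have hN' : (0 : ℝ) < N := by exact_mod_cast hN
  simp only [gridTau, gridT, Nat.add_sub_cancel, sub_pos]
  gcongr
  exact j.lt_succ_self

lemma gridTau_succ_le (hT : 0 < T) (hr : 1 ≤ r) (j : ℕ) :
    gridTau T r N (j + 1) ≤ gridTau T r N (j + 2) := by
  have hx : (j : ℝ) / N ∈ Ici (0 : ℝ) := mem_Ici.2 (by positivity)
  have hy : ((j + 2 : ℕ) : ℝ) / N ∈ Ici (0 : ℝ) := mem_Ici.2 (by positivity)
  have h := (convexOn_rpow hr).2 hx hy (by norm_num : (0 : ℝ) ≤ 1 / 2)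
    (by norm_num : (0 : ℝ) ≤ 1 / 2) (by norm_num)
  have hm : (1 / 2 : ℝ) • ((j : ℝ) / N) + (1 / 2 : ℝ) • (((j + 2 : ℕ) : ℝ) / N)
      = ((j + 1 : ℕ) : ℝ) / N := by
    push_cast
    simp only [smul_eq_mul]
    ring
  rw [hm] at h
  simp only [smul_eq_mul] at h
  simp only [gridTau, gridT, Nat.add_sub_cancel, show j + 2 - 1 = j + 1 from rfl]
  nlinarith [mul_le_mul_of_nonneg_left h hT.le]

lemma gridT_mono (hT : 0 < T) (hr : 1 ≤ r) : Monotone (gridT T r N) := by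
  intro i j hij
  simp only [gridT]
  gcongr

lemma gridT_lt_tTheta (hT : 0 < T) (hr : 1 ≤ r) (hN : 1 ≤ N) {θ : ℝ} (hθ : θ ≤ 1 / 2) {j n : ℕ}
    (hjn : j < n) : gridT T r N j < tTheta T r N n θ := by
  obtain ⟨m, rfl⟩ : ∃ m, n = m + 1 := ⟨n - 1, by omega⟩
  have h1 : gridT T r N j ≤ gridT T r N m := gridT_mono hT hr (by omega)
  have h2 := gridTau_succ_pos hT hr hN m
  simp only [gridTau, Nat.add_sub_cancel] at h2
  simp only [tTheta, Nat.add_sub_cancel]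
  nlinarith

end Mesh

section Coefficients

variable {T r θ α : ℝ} {N n : ℕ}

lemma coefI_eq (hT : 0 < T) (hr : 1 ≤ r) (hN : 1 ≤ N) (hθ : θ ≤ 1 / 2) {k : ℕ} (hk : k + 1 < n) :
    coefI T r N n θ α (k + 1) = coefA T r N n θ α (k + 1)
      - (tTheta T r N n θ - gridT T r N k) ^ (-α) / Real.Gamma (1 - α) := by
  have hv := gridT_lt_tTheta hT hr hN hθ hk
  have hτ := gridTau_succ_pos hT hr hN k
  have h := integral_sub_mul_sub_rpow (α := α) (gridT_mono hT hr k.le_succ) hv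
  simp only [coefI, coefA, Nat.add_sub_cancel, min_eq_left hv.le]
  rw [div_mul_eq_mul_div, h]
  have : gridT T r N (k + 1) - gridT T r N k = gridTau T r N (k + 1) := by simp [gridTau]
  rw [this, sub_div, mul_comm (gridTau T r N (k + 1)), mul_div_mul_right _ _ hτ.ne']
  ring

lemma coefI_nonneg (hT : 0 < T) (hr : 1 ≤ r) (hN : 1 ≤ N) (hθ : θ ≤ 1 / 2) (hα0 : 0 < α)
    (hα1 : α < 1) {k : ℕ} (hk : k + 1 < n) : 0 ≤ coefI T r N n θ α (k + 1) := by
  have hv := gridT_lt_tTheta hT hr hN hθ hk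
  have hG : 0 < Real.Gamma (1 - α) := Real.Gamma_pos_of_pos (by linarith)
  have hτ := gridTau_succ_pos hT hr hN k
  refine mul_nonneg (by positivity) (intervalIntegral.integral_nonneg ?_ fun s hs => ?_)
  · exact gridT_mono hT hr (by omega)
  · exact mul_nonneg (sub_nonneg.2 hs.2) (rpow_nonneg (by linarith [hs.2]) _)

lemma coefB_le_half_coefI (hT : 0 < T) (hr : 1 ≤ r) (hN : 1 ≤ N) (hθ : θ ≤ 1 / 2) (hα0 : 0 < α)
    (hα1 : α < 1) {k : ℕ} (hk : k + 1 < n) :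
    coefB T r N n θ α (k + 1) ≤ coefI T r N n θ α (k + 1) / 2 := by
  have hv := gridT_lt_tTheta hT hr hN hθ hk
  have hG : 0 < Real.Gamma (1 - α) := Real.Gamma_pos_of_pos (by linarith)
  have hτ := gridTau_succ_pos hT hr hN k
  have hτ' : gridTau T r N (k + 1) ≤ gridTau T r N (k + 1 + 1) := gridTau_succ_le hT hr k
  have hI := coefI_nonneg hT hr hN hθ hα0 hα1 hk
  have hle : gridT T r N k ≤ gridT T r N (k + 1) := gridT_mono hT hr k.le_succ
  have hsub : Icc (gridT T r N k) (gridT T r N (k + 1)) ⊆ Iio (tTheta T r N n θ) :=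
    fun s hs => hs.2.trans_lt hv
  have h := ((monotoneOn_sub_rpow_neg hα0.le).mono hsub).integral_sub_midpoint_mul_le
    (continuousOn_sub_rpow_neg.mono hsub) hle
  rw [← integral_sub_mul_sub_rpow hle hv] at h
  simp only [coefI, coefB, Nat.add_sub_cancel] at hI ⊢
  have hd : gridT T r N (k + 1) - gridT T r N k = gridTau T r N (k + 1) := by simp [gridTau]
  rw [hd] at h
  set τ := gridTau T r N (k + 1)
  set τ' := gridTau T r N (k + 1 + 1)
  set M := ∫ s in gridT T r N k..gridT T r N (k + 1),
    (gridT T r N (k + 1) - s) * (tTheta T r N n θ - s) ^ (-α - 1)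
  set G := Real.Gamma (1 - α)
  have hτ'' : 0 < τ + τ' := by linarith
  calc _ ≤ 2 / (τ * (τ + τ') * G) * (τ / 2 * (α * M)) :=
        mul_le_mul_of_nonneg_left h (by positivity)
    _ = τ / (τ + τ') * (α / (G * τ) * M) := by field_simp
    _ ≤ 1 / 2 * (α / (G * τ) * M) := by
        refine mul_le_mul_of_nonneg_right ?_ hI
        rw [div_le_div_iff₀ hτ'' two_pos]
        linarith
    _ = _ := by ring

lemma two_mul_coefA_le (hT : 0 < T) (hr : 1 ≤ r) (hN : 1 ≤ N) (hθ : θ ≤ 1 / 2) (hα0 : 0 < α)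
    (hα1 : α < 1) {k : ℕ} (hk : k + 1 < n) :
    2 * coefA T r N n θ α (k + 1)
      ≤ (tTheta T r N n θ - gridT T r N k) ^ (-α) / Real.Gamma (1 - α)
        + (tTheta T r N n θ - gridT T r N (k + 1)) ^ (-α) / Real.Gamma (1 - α) := by
  have hv := gridT_lt_tTheta hT hr hN hθ hk
  have hG : 0 < Real.Gamma (1 - α) := Real.Gamma_pos_of_pos (by linarith)
  have hτ := gridTau_succ_pos hT hr hN k
  have hd : gridT T r N (k + 1) - gridT T r N k = gridTau T r N (k + 1) := by simp [gridTau]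
  have hsub : Icc (gridT T r N k) (gridT T r N (k + 1)) ⊆ Iio (tTheta T r N n θ) :=
    fun s hs => hs.2.trans_lt hv
  have h := ((convexOn_sub_rpow_neg hα0.le).subset hsub (convex_Icc _ _)).integral_le_trapezoid
    (continuousOn_sub_rpow_neg.mono hsub) (by linarith)
  rw [hd] at h
  simp only [coefA, Nat.add_sub_cancel, min_eq_left hv.le]
  calc _ ≤ 2 * (1 / (gridTau T r N (k + 1) * Real.Gamma (1 - α)) * _) :=
        mul_le_mul_of_nonneg_left (mul_le_mul_of_nonneg_left h (by positivity)) two_pos.le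
    _ = _ := by field_simp

lemma le_two_mul_coefI_succ (hT : 0 < T) (hr : 1 ≤ r) (hN : 1 ≤ N) (hθ : θ ≤ 1 / 2) (hα0 : 0 < α)
    (hα1 : α < 1) {k : ℕ} (hk : k + 2 < n) :
    (tTheta T r N n θ - gridT T r N (k + 1)) ^ (-α) / Real.Gamma (1 - α)
        - (tTheta T r N n θ - gridT T r N k) ^ (-α) / Real.Gamma (1 - α)
      ≤ 2 * coefI T r N n θ α (k + 2) := by
  have hw : gridT T r N (k + 2) < _ := gridT_lt_tTheta hT hr hN hθ hk
  have hG : 0 < Real.Gamma (1 - α) := Real.Gamma_pos_of_pos (by linarith)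
  have hτ := gridTau_succ_pos hT hr hN k
  have hτ' : 0 < gridTau T r N (k + 2) := gridTau_succ_pos hT hr hN (k + 1)
  have hττ : gridTau T r N (k + 1) ≤ gridTau T r N (k + 2) := gridTau_succ_le hT hr k
  have hd : gridT T r N (k + 1) - gridT T r N k = gridTau T r N (k + 1) := by simp [gridTau]
  have hd' : gridT T r N (k + 2) - gridT T r N (k + 1) = gridTau T r N (k + 2) := by
    simp [gridTau]
  have hsub : Icc (gridT T r N k) (gridT T r N (k + 2)) ⊆ Iio (tTheta T r N n θ) :=
    fun s hs => hs.2.trans_lt hw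
  have h := ((convexOn_sub_rpow_neg hα0.le).subset hsub (convex_Icc _ _)).secant_le_integral
    (continuousOn_sub_rpow_neg.mono hsub) (v := gridT T r N (k + 1)) (by linarith) (by linarith)
  have hmono : (tTheta T r N n θ - gridT T r N k) ^ (-α)
      ≤ (tTheta T r N n θ - gridT T r N (k + 1)) ^ (-α) :=
    rpow_le_rpow_of_nonpos (by linarith) (by linarith) (by linarith)
  rw [hd, hd'] at h
  rw [coefI_eq hT hr hN hθ hk]
  simp only [coefA, show k + 2 - 1 = k + 1 from rfl, min_eq_left hw.le]
  set τ := gridTau T r N (k + 1)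
  set τ' := gridTau T r N (k + 2)
  set p := (tTheta T r N n θ - gridT T r N k) ^ (-α)
  set q := (tTheta T r N n θ - gridT T r N (k + 1)) ^ (-α)
  set M := ∫ s in gridT T r N (k + 1)..gridT T r N (k + 2), (tTheta T r N n θ - s) ^ (-α)
  set G := Real.Gamma (1 - α)
  have hslope : q - p ≤ (q - p) / τ * τ' := by
    rw [div_mul_eq_mul_div, le_div_iff₀ hτ]
    exact mul_le_mul_of_nonneg_left hττ (sub_nonneg.2 hmono)
  have hM : q + (q - p) / 2 ≤ M / τ' := by
    rw [le_div_iff₀ hτ']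
    nlinarith
  calc q / G - p / G = 2 * ((q + (q - p) / 2) / G - q / G) := by ring
    _ ≤ 2 * (M / τ' / G - q / G) := by gcongr
    _ = _ := by field_simp

lemma coefI_le_coefI_succ (hT : 0 < T) (hr : 1 ≤ r) (hN : 1 ≤ N) (hθ : θ ≤ 1 / 2) (hα0 : 0 < α)
    (hα1 : α < 1) {k : ℕ} (hk : k + 2 < n) :
    coefI T r N n θ α (k + 1) ≤ coefI T r N n θ α (k + 2) := by
  have hk' : k + 1 < n := by omega
  linarith [le_two_mul_coefI_succ hT hr hN hθ hα0 hα1 hk,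
    two_mul_coefA_le hT hr hN hθ hα0 hα1 hk', coefI_eq (α := α) hT hr hN hθ hk']

lemma coefI_add_coefI_succ_le (hT : 0 < T) (hr : 1 ≤ r) (hN : 1 ≤ N) (hθ : θ ≤ 1 / 2)
    (hα0 : 0 < α) (hα1 : α < 1) {k : ℕ} (hk : k + 2 < n) :
    coefI T r N n θ α (k + 1) + coefI T r N n θ α (k + 2)
      ≤ coefA T r N n θ α (k + 2) - coefA T r N n θ α (k + 1) := by
  have hk' : k + 1 < n := by omega
  have h : coefI T r N n θ α (k + 2) = _ := coefI_eq (α := α) hT hr hN hθ hk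
  linarith [two_mul_coefA_le hT hr hN hθ hα0 hα1 hk', coefI_eq (α := α) hT hr hN hθ hk']

end Coefficients

/-- For `3 ≤ n ≤ N`: `a_{n-2}^{(α)} - a_{n-1}^{(α)} ≥ b_{n-2}^{(α)} + (3/2) I_{n-1}^{(α)}`,
and for `2 ≤ k ≤ n-2`:
`a_{n-k-1}^{(α)} - a_{n-k}^{(α)} ≥ b_{n-k-1}^{(α)} + ρ_{k-1} b_{n-k+1}^{(α)} + I_{n-k}^{(α)}`. -/
theorem coefA_diff_lower (T r : ℝ) (N n : ℕ) (θ α : ℝ)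
    (hT : 0 < T) (hr : 1 ≤ r) (hN : 1 ≤ N) (hn3 : 3 ≤ n) (hnN : n ≤ N)
    (hθ0 : 0 ≤ θ) (hθ : θ ≤ 1 / 2) (hα0 : 0 < α) (hα1 : α < 1) :
    coefB T r N n θ α 2 + (3 / 2) * coefI T r N n θ α 1
        ≤ coefA T r N n θ α 2 - coefA T r N n θ α 1 ∧
    (∀ k : ℕ, 2 ≤ k → k ≤ n - 2 →
      coefB T r N n θ α (k + 1) + gridRho T r N (k - 1) * coefB T r N n θ α (k - 1)
          + coefI T r N n θ α k
        ≤ coefA T r N n θ α (k + 1) - coefA T r N n θ α k) := by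
  constructor
  · have hB : coefB T r N n θ α 2 ≤ coefI T r N n θ α 2 / 2 :=
      coefB_le_half_coefI hT hr hN hθ hα0 hα1 (by omega)
    have hI : coefI T r N n θ α 1 ≤ coefI T r N n θ α 2 :=
      coefI_le_coefI_succ hT hr hN hθ hα0 hα1 (by omega)
    have hA : coefI T r N n θ α 1 + coefI T r N n θ α 2
        ≤ coefA T r N n θ α 2 - coefA T r N n θ α 1 :=
      coefI_add_coefI_succ_le hT hr hN hθ hα0 hα1 (by omega)
    linarith
  · intro k hk2 hkn
    obtain ⟨m, rfl⟩ : ∃ m, k = m + 2 := ⟨k - 2, by omega⟩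
    have hB : coefB T r N n θ α (m + 2 + 1) ≤ _ :=
      coefB_le_half_coefI hT hr hN hθ hα0 hα1 (by omega)
    have hB' : coefB T r N n θ α (m + 1) ≤ _ :=
      coefB_le_half_coefI hT hr hN hθ hα0 hα1 (by omega)
    have hI0 : 0 ≤ coefI T r N n θ α (m + 1) := coefI_nonneg hT hr hN hθ hα0 hα1 (by omega)
    have hI : coefI T r N n θ α (m + 1) ≤ coefI T r N n θ α (m + 2) :=
      coefI_le_coefI_succ hT hr hN hθ hα0 hα1 (by omega)
    have hI' : coefI T r N n θ α (m + 2) ≤ coefI T r N n θ α (m + 2 + 1) :=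
      coefI_le_coefI_succ hT hr hN hθ hα0 hα1 (by omega)
    have hA : coefI T r N n θ α (m + 2) + coefI T r N n θ α (m + 2 + 1)
        ≤ coefA T r N n θ α (m + 2 + 1) - coefA T r N n θ α (m + 2) :=
      coefI_add_coefI_succ_le hT hr hN hθ hα0 hα1 (by omega)
    have hτ := gridTau_succ_pos hT hr hN m
    have hτ' : 0 < gridTau T r N (m + 2) := gridTau_succ_pos hT hr hN (m + 1)
    have hρ0 : 0 ≤ gridRho T r N (m + 1) := (div_pos hτ hτ').le
    have hρ1 : gridRho T r N (m + 1) ≤ 1 := (div_le_one hτ').2 (gridTau_succ_le hT hr m)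
    rw [show m + 2 - 1 = m + 1 from rfl]
    have hρB : gridRho T r N (m + 1) * coefB T r N n θ α (m + 1)
        ≤ coefI T r N n θ α (m + 1) / 2 :=
      (mul_le_mul_of_nonneg_left hB' hρ0).trans (mul_le_of_le_one_left (by linarith) hρ1)
    linarith
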